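/- Even moments of the general ratio deviation (Lemma 5, even case): for all fixed q ≥ 1, r ≥ 1 and s ≥ 0, the expectation ⟨(S_{q+r,n}/S_{q,n} − 1/4^r)^{2s}⟩ under P_n is asymptotically equivalent, as n → ∞, to 4^{s(q−1)}·((2s−1)!!/4^{2sr})·((4^r − 1)/3)^s·n^{−s}. -/

import Mathlib

open MeasureTheory ProbabilityTheory Filter
open scoped NNReal Topology

/-- Binary trees: every internal node has exactly two children. -/
inductive BinTree : Type
  | leaf : BinTree
  | node : BinTree → BinTree → BinTree
  deriving DecidableEq

namespace BinTree

/-- The magnitude of a binary tree is its number of leaves. -/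
def magnitude : BinTree → ℕ
  | leaf => 1
  | node l r => magnitude l + magnitude r

/-- The Horton–Strahler order of (the root of) a binary tree:
leaves have order 1; a node whose two children have distinct orders has the max of the two;
a node whose two children have equal order `r` has order `r + 1`. -/
def ord : BinTree → ℕ
  | leaf => 1
  | node l r => if ord l = ord r then ord l + 1 else max (ord l) (ord r)

/-- `branches k τ` is `S_{k,n}(τ)`, the number of Horton–Strahler branches of order `k`
in `τ`, i.e. the number of maximal connected paths of nodes of order `k`.  It counts the
nodes of order `k` that head a branch: a new branch head of order `ord l + 1` is created
exactly at a node whose two children have equal order `ord l`, and every leaf heads an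
order-1 branch. -/
def branches (k : ℕ) : BinTree → ℕ
  | leaf => if k = 1 then 1 else 0
  | node l r => branches k l + branches k r +
      (if ord l = ord r ∧ ord l + 1 = k then 1 else 0)

end BinTree

/-- `treesOf n` is the finite set `Ω_n` of binary trees of magnitude `n`. -/
def treesOf : ℕ → Finset BinTree
  | 0 => ∅
  | 1 => {BinTree.leaf}
  | (n+2) => (Finset.range (n+1)).attach.biUnion fun k =>
      ((treesOf (k.1+1)) ×ˢ (treesOf (n+1-k.1))).image fun p => BinTree.node p.1 p.2
  decreasing_by
  · have := Finset.mem_range.mp k.2; omega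
  · omega

/-- Expectation `⟨f⟩` under the uniform probability measure `P_n` on `Ω_n` (the random model). -/
noncomputable def expect (n : ℕ) (f : BinTree → ℝ) : ℝ :=
  (∑ τ ∈ treesOf n, f τ) / (treesOf n).card

namespace BinTree

/-- Remove all leaves of a tree and contract the resulting chains (a single leaf is kept). -/
def prune : BinTree → BinTree
  | leaf => leaf
  | node leaf r => prune r
  | node l leaf => prune l
  | node l r => node (prune l) (prune r)

lemma one_le_ord (τ : BinTree) : 1 ≤ ord τ := by
  induction τ with
  | leaf => simp [ord]
  | node l r hl hr => simp only [ord]; split_ifs <;> omega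

lemma one_le_magnitude (τ : BinTree) : 1 ≤ magnitude τ := by
  induction τ with
  | leaf => simp [magnitude]
  | node l r hl hr => simp only [magnitude]; omega

lemma prune_leaf_node (r : BinTree) : prune (node leaf r) = prune r := by
  rw [prune]

lemma prune_node_leaf (l : BinTree) : prune (node l leaf) = prune l := by
  cases l <;> simp [prune]

lemma prune_node {l r : BinTree} (hl : l ≠ leaf) (hr : r ≠ leaf) :
    prune (node l r) = node (prune l) (prune r) := by
  cases l <;> cases r <;> simp_all [prune]

lemma magnitude_prune_le (τ : BinTree) : magnitude (prune τ) ≤ magnitude τ := by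
  induction τ with
  | leaf => simp [prune]
  | node l r hl hr =>
    by_cases h1 : l = leaf
    · subst h1; rw [prune_leaf_node]; simp only [magnitude]; omega
    by_cases h2 : r = leaf
    · subst h2; rw [prune_node_leaf]; simp only [magnitude]; omega
    rw [prune_node h1 h2]; simp only [magnitude]; omega

lemma ord_eq_ord_prune_add_one {τ : BinTree} (hτ : τ ≠ leaf) : ord τ = ord (prune τ) + 1 := by
  induction τ with
  | leaf => exact absurd rfl hτ
  | node l r hl hr =>
    have h0 : ord leaf = 1 := rfl
    by_cases h1 : l = leaf
    · subst h1
      rw [prune_leaf_node]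
      by_cases h2 : r = leaf
      · subst h2; simp [ord, prune]
      · have := hr h2
        have := one_le_ord (prune r)
        rw [ord, h0, if_neg (by omega)]; omega
    by_cases h2 : r = leaf
    · subst h2
      rw [prune_node_leaf]
      have := hl h1
      have := one_le_ord (prune l)
      rw [ord, h0, if_neg (by omega)]; omega
    rw [prune_node h1 h2, ord, ord, hl h1, hr h2]
    split_ifs <;> omega

lemma branches_succ {k : ℕ} (hk : 1 ≤ k) {τ : BinTree} (hτ : τ ≠ leaf) :
    branches (k + 1) τ = branches k (prune τ) := by
  induction τ with
  | leaf => exact absurd rfl hτ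
  | node l r hl hr =>
    have h0 : ord leaf = 1 := rfl
    have hb : branches (k + 1) leaf = 0 := by rw [branches, if_neg (by omega)]
    by_cases h1 : l = leaf
    · subst h1
      rw [prune_leaf_node]
      by_cases h2 : r = leaf
      · subst h2
        have : k = 1 ↔ 2 = k + 1 := by omega
        simp only [branches, ord, prune, this]
        simp
        omega
      · have := ord_eq_ord_prune_add_one h2
        have := one_le_ord (prune r)
        rw [branches, hb, h0, if_neg (by omega), hr h2]; omega
    by_cases h2 : r = leaf
    · subst h2
      rw [prune_node_leaf]
      have := ord_eq_ord_prune_add_one h1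
      have := one_le_ord (prune l)
      rw [branches, hb, h0, if_neg (by omega), hl h1]; omega
    rw [prune_node h1 h2, branches, branches, hl h1, hr h2,
      ord_eq_ord_prune_add_one h1, ord_eq_ord_prune_add_one h2]
    simp

lemma branches_one (τ : BinTree) : branches 1 τ = magnitude τ := by
  induction τ with
  | leaf => simp [branches, magnitude]
  | node l r hl hr =>
    have := one_le_ord l
    rw [branches, magnitude, hl, hr, if_neg (by omega), add_zero]

end BinTree

section

open BinTree
open Finset hiding expect

lemma mem_treesOf {n : ℕ} {τ : BinTree} : τ ∈ treesOf n ↔ magnitude τ = n := by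
  induction n using Nat.strong_induction_on generalizing τ with
  | _ n ih =>
    match n with
    | 0 => have := one_le_magnitude τ; simp [treesOf]; omega
    | 1 =>
      cases τ with
      | leaf => simp [treesOf, magnitude]
      | node l r =>
        have := one_le_magnitude l
        have := one_le_magnitude r
        simp [treesOf, magnitude]; omega
    | n + 2 =>
      simp only [treesOf, mem_biUnion, mem_attach, true_and, mem_image, mem_product, Prod.exists]
      constructor
      · rintro ⟨⟨k, hk⟩, l, r, ⟨hl, hr⟩, rfl⟩
        have hk' := mem_range.mp hk
        rw [ih _ (by simp only; omega)] at hl hr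
        simp only at hl hr
        simp only [magnitude]; omega
      · intro h
        cases τ with
        | leaf => simp [magnitude] at h
        | node l r =>
          have := one_le_magnitude l
          have := one_le_magnitude r
          simp only [magnitude] at h
          refine ⟨⟨magnitude l - 1, mem_range.mpr (by omega)⟩, l, r, ⟨?_, ?_⟩, rfl⟩
          · rw [ih _ (by simp only; omega)]; simp only; omega
          · rw [ih _ (by simp only; omega)]; simp only; omega

lemma sum_treesOf {M : Type*} [AddCommMonoid M] (n : ℕ) (F : BinTree → M) :
    ∑ τ ∈ treesOf n, F τ = (if n = 1 then F leaf else 0) +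
      ∑ p ∈ antidiagonal n, ∑ l ∈ treesOf p.1, ∑ r ∈ treesOf p.2, F (node l r) := by
  have key : treesOf n = (if n = 1 then {leaf} else ∅) ∪
      (antidiagonal n).biUnion fun p =>
        (treesOf p.1 ×ˢ treesOf p.2).image fun q => node q.1 q.2 := by
    ext τ
    cases τ with
    | leaf => by_cases hn : n = 1 <;> simp [mem_treesOf, magnitude, hn, eq_comm]
    | node l r => by_cases hn : n = 1 <;> simp [mem_treesOf, magnitude, hn]
  rw [key, sum_union, sum_biUnion]
  · congr 1
    · split_ifs <;> simp
    · refine sum_congr rfl fun p _ => ?_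
      rw [sum_image, sum_product]
      rintro ⟨a, b⟩ _ ⟨c, d⟩ _ h
      simpa using h
  · rintro ⟨a, b⟩ _ ⟨c, d⟩ _ h
    rw [Function.onFun, disjoint_left]
    rintro τ h1 h2
    simp only [mem_image, mem_product, mem_treesOf, Prod.exists] at h1 h2
    obtain ⟨l, r, ⟨rfl, rfl⟩, rfl⟩ := h1
    obtain ⟨l', r', ⟨rfl, rfl⟩, h3⟩ := h2
    cases h3
    exact h rfl
  · rw [disjoint_left]
    intro τ h1 h2
    split_ifs at h1
    · simp at h1; subst h1; simp at h2
    · simp at h1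

/-- The number of trees of magnitude `n`, other than a single leaf, whose pruning is `σ`. -/
def pruneCount (σ : BinTree) (n : ℕ) : ℕ :=
  ∑ τ ∈ treesOf n, if τ ≠ leaf ∧ prune τ = σ then 1 else 0

/-- The generating function of `pruneCount`. -/
noncomputable def pruneSeries (σ : BinTree) : PowerSeries ℤ :=
  PowerSeries.mk fun n => (pruneCount σ n : ℤ)

lemma sum_treesOf_eq_leaf (n : ℕ) :
    ∑ τ ∈ treesOf n, (if τ = leaf then (1 : ℤ) else 0) = PowerSeries.coeff n PowerSeries.X := by
  rw [sum_ite_eq', PowerSeries.coeff_X]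
  simp [mem_treesOf, magnitude, eq_comm]

lemma coeff_pruneSeries (σ : BinTree) (n : ℕ) :
    PowerSeries.coeff n (pruneSeries σ) =
      ∑ τ ∈ treesOf n, if τ ≠ leaf ∧ prune τ = σ then (1 : ℤ) else 0 := by
  rw [pruneSeries, PowerSeries.coeff_mk, pruneCount]
  push_cast
  rfl

lemma pruneSeries_leaf :
    pruneSeries leaf = PowerSeries.X ^ 2 + 2 * (PowerSeries.X * pruneSeries leaf) := by
  ext n
  rw [coeff_pruneSeries, sum_treesOf, two_mul, map_add, map_add, sq]
  nth_rw 3 [mul_comm]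
  simp only [PowerSeries.coeff_mul, ← sum_treesOf_eq_leaf, coeff_pruneSeries, sum_mul_sum]
  simp only [ne_eq, not_true_eq_false, false_and, if_false, ite_self, zero_add, ← sum_add_distrib]
  refine sum_congr rfl fun p _ => sum_congr rfl fun l _ => sum_congr rfl fun r _ => ?_
  by_cases h1 : l = leaf
  · subst h1
    by_cases h2 : r = leaf
    · subst h2; simp [prune]
    · simp [prune_leaf_node, h2]
  by_cases h2 : r = leaf
  · subst h2; simp [prune_node_leaf, h1]
  · simp [prune_node h1 h2, h1, h2]

lemma pruneSeries_node (a b : BinTree) :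
    pruneSeries (node a b) =
      2 * (PowerSeries.X * pruneSeries (node a b)) + pruneSeries a * pruneSeries b := by
  ext n
  rw [coeff_pruneSeries, sum_treesOf, two_mul, map_add, map_add]
  nth_rw 2 [mul_comm]
  simp only [PowerSeries.coeff_mul, ← sum_treesOf_eq_leaf, coeff_pruneSeries, sum_mul_sum]
  simp only [ne_eq, not_true_eq_false, false_and, if_false, ite_self, zero_add, ← sum_add_distrib]
  refine sum_congr rfl fun p _ => sum_congr rfl fun l _ => sum_congr rfl fun r _ => ?_
  by_cases h1 : l = leaf
  · subst h1
    by_cases h2 : r = leaf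
    · subst h2; simp [prune]
    · simp [prune_leaf_node, h2]
  by_cases h2 : r = leaf
  · subst h2; simp [prune_node_leaf, h1]
  · simp only [prune_node h1 h2, h1, h2, node.injEq, not_false_eq_true, true_and, ite_and]
    by_cases h3 : l.prune = a <;> by_cases h4 : r.prune = b <;> simp [h3, h4]

lemma pruneSeries_mul_pow (σ : BinTree) :
    pruneSeries σ * (1 - 2 * PowerSeries.X) ^ (2 * magnitude σ - 1) =
      PowerSeries.X ^ (2 * magnitude σ) := by
  induction σ with
  | leaf =>
    have := pruneSeries_leaf
    simp only [magnitude]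
    linear_combination this
  | node a b ha hb =>
    have h := pruneSeries_node a b
    have h1 := one_le_magnitude a
    have h2 := one_le_magnitude b
    have e1 : 2 * magnitude (node a b) - 1 =
        (2 * magnitude a - 1) + (2 * magnitude b - 1) + 1 := by
      simp only [magnitude]; omega
    have e2 : 2 * magnitude (node a b) = 2 * magnitude a + 2 * magnitude b := by
      simp only [magnitude]; omega
    rw [e1, e2, pow_add, pow_add, pow_add, ← ha, ← hb]
    linear_combination (1 - 2 * PowerSeries.X) ^ (2 * magnitude a - 1) *
      (1 - 2 * PowerSeries.X) ^ (2 * magnitude b - 1) * h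

/-- The number of trees of magnitude `n ≥ 2` that prune to a given tree of magnitude `k ≥ 1`. -/
def pruneWeight (n k : ℕ) : ℕ :=
  if 2 * k ≤ n then 2 ^ (n - 2 * k) * (n - 2).choose (2 * k - 2) else 0

lemma pruneCount_eq (σ : BinTree) (n : ℕ) : pruneCount σ n = pruneWeight n (magnitude σ) := by
  obtain ⟨m, hm⟩ : ∃ m, magnitude σ = m + 1 := ⟨magnitude σ - 1, by
    have := one_le_magnitude σ; omega⟩
  have h := pruneSeries_mul_pow σ
  have hinv : (1 - 2 * PowerSeries.X : PowerSeries ℤ) *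
      PowerSeries.rescale 2 (PowerSeries.mk 1) = 1 := by
    have h1 := congrArg (PowerSeries.rescale (2 : ℤ)) (PowerSeries.mk_one_mul_one_sub_eq_one ℤ)
    rw [map_mul, map_sub, map_one, PowerSeries.rescale_X, mul_comm] at h1
    simpa using h1
  have h2 : pruneSeries σ = PowerSeries.X ^ (2 * magnitude σ) *
      PowerSeries.rescale 2 (PowerSeries.mk 1 ^ (2 * m + 1)) := by
    rw [← h, map_pow, mul_assoc, show 2 * magnitude σ - 1 = 2 * m + 1 by omega, ← mul_pow, hinv,
      one_pow, mul_one]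
  rw [PowerSeries.mk_one_pow_eq_mk_choose_add] at h2
  have h3 := congrArg (PowerSeries.coeff n) h2
  rw [PowerSeries.coeff_X_pow_mul', pruneSeries, PowerSeries.coeff_mk] at h3
  rw [pruneWeight]
  split_ifs at h3 ⊢ with hk
  · rw [PowerSeries.coeff_rescale, PowerSeries.coeff_mk] at h3
    rw [show n - 2 = 2 * m + (n - 2 * magnitude σ) by omega,
      show 2 * magnitude σ - 2 = 2 * m by omega]
    exact_mod_cast h3
  · exact_mod_cast h3

lemma sum_treesOf_prune {n : ℕ} (hn : 2 ≤ n) (F : BinTree → ℝ) :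
    ∑ τ ∈ treesOf n, F (prune τ) =
      ∑ k ∈ range (n + 1), (pruneWeight n k : ℝ) * ∑ σ ∈ treesOf k, F σ := by
  have h1 : ∀ τ ∈ treesOf n, F (prune τ) = ∑ k ∈ range (n + 1), ∑ σ ∈ treesOf k,
      (if τ ≠ leaf ∧ prune τ = σ then (1 : ℝ) else 0) * F σ := by
    intro τ hτ
    rw [mem_treesOf] at hτ
    have hl : τ ≠ leaf := by rintro rfl; simp [magnitude] at hτ; omega
    rw [sum_eq_single (magnitude (prune τ)), sum_eq_single (prune τ)]
    · simp [hl]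
    · intro σ _ h; simp [h.symm]
    · intro h; exact absurd (mem_treesOf.mpr rfl) h
    · intro k _ hk
      refine sum_eq_zero fun σ hσ => ?_
      rw [mem_treesOf] at hσ
      rw [if_neg, zero_mul]
      rintro ⟨-, rfl⟩
      exact hk hσ.symm
    · intro h
      have := magnitude_prune_le τ
      simp at h; omega
  rw [sum_congr rfl h1, sum_comm]
  refine sum_congr rfl fun k _ => ?_
  rw [sum_comm, mul_sum]
  refine sum_congr rfl fun σ hσ => ?_
  rw [← sum_mul]
  congr 1
  rw [mem_treesOf] at hσ
  rw [← hσ, ← pruneCount_eq, pruneCount]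
  push_cast
  rfl

lemma card_treesOf_succ (n : ℕ) : #(treesOf (n + 1)) = catalan n := by
  induction n using Nat.strong_induction_on with
  | _ n ih =>
    match n with
    | 0 => simp [treesOf]
    | n + 1 =>
      rw [card_eq_sum_ones, sum_treesOf, if_neg (by omega), zero_add, catalan_succ',
        Finset.Nat.antidiagonal_succ_succ']
      simp only [sum_const, smul_eq_mul, mul_one, sum_cons, sum_map]
      simp only [treesOf, card_empty, zero_mul, mul_zero, zero_add]
      refine sum_congr rfl fun p hp => ?_
      have := mem_antidiagonal.mp hp
      simp only [Function.Embedding.prodMap, Function.Embedding.coeFn_mk, Prod.map]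
      rw [Nat.succ_eq_add_one, Nat.succ_eq_add_one, ih _ (by omega), ih _ (by omega)]

lemma card_treesOf_pos {n : ℕ} (hn : 1 ≤ n) : 0 < #(treesOf n) := by
  obtain ⟨m, rfl⟩ : ∃ m, n = m + 1 := ⟨n - 1, by omega⟩
  rw [card_treesOf_succ]
  have := succ_mul_catalan_eq_centralBinom m
  have := Nat.centralBinom_pos m
  by_contra h
  simp at h
  simp [h] at *
  omega

lemma card_treesOf_succ_mul {k : ℕ} (hk : 1 ≤ k) :
    (k + 1) * #(treesOf (k + 1)) = 2 * (2 * k - 1) * #(treesOf k) := by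
  obtain ⟨m, rfl⟩ : ∃ m, k = m + 1 := ⟨k - 1, by omega⟩
  rw [card_treesOf_succ, card_treesOf_succ, succ_mul_catalan_eq_centralBinom]
  have h1 := succ_mul_catalan_eq_centralBinom m
  have h2 := Nat.succ_mul_centralBinom_succ m
  rw [← h1] at h2
  have : (m + 1) * (m + 1).centralBinom = (m + 1) * (2 * (2 * m + 1) * catalan m) := by
    rw [h2]; ring
  rw [Nat.eq_of_mul_eq_mul_left (by omega) this, show 2 * (m + 1) - 1 = 2 * m + 1 by omega]

/-- The probability that a uniform tree of magnitude `n ≥ 2` prunes to a tree of magnitude `k`. -/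
noncomputable def pruneProb (n k : ℕ) : ℝ :=
  (pruneWeight n k : ℝ) * #(treesOf k) / #(treesOf n)

/-- The mean of a function of the magnitude of the pruning of a uniform tree. -/
noncomputable def pruneMean (n : ℕ) (g : ℕ → ℝ) : ℝ :=
  ∑ k ∈ range (n + 1), pruneProb n k * g k

lemma expectation_congr {n : ℕ} {f g : BinTree → ℝ} (h : ∀ τ, magnitude τ = n → f τ = g τ) :
    expect n f = expect n g := by
  rw [expect, expect, sum_congr rfl fun τ hτ => h τ (mem_treesOf.mp hτ)]

lemma expectation_const {n : ℕ} (hn : 1 ≤ n) (c : ℝ) : expect n (fun _ => c) = c := by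
  have : (#(treesOf n) : ℝ) ≠ 0 := by exact_mod_cast (card_treesOf_pos hn).ne'
  rw [expect, sum_const, nsmul_eq_mul]
  field_simp

lemma expectation_sum_mul {ι : Type*} (n : ℕ) (s : Finset ι) (c : ι → ℝ) (f : ι → BinTree → ℝ) :
    expect n (fun τ => ∑ i ∈ s, c i * f i τ) = ∑ i ∈ s, c i * expect n (f i) := by
  simp only [expect]
  rw [sum_comm, sum_div]
  refine sum_congr rfl fun i _ => ?_
  rw [← mul_sum, mul_div_assoc]

lemma expectation_const_mul (n : ℕ) (c : ℝ) (f : BinTree → ℝ) :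
    expect n (fun τ => c * f τ) = c * expect n f := by
  rw [expect, expect, ← mul_sum, mul_div_assoc]

lemma expectation_prune {n : ℕ} (hn : 2 ≤ n) (F : BinTree → ℝ) :
    expect n (fun τ => F (prune τ)) = pruneMean n (fun k => expect k F) := by
  rw [expect, sum_treesOf_prune hn, pruneMean, sum_div]
  refine sum_congr rfl fun k _ => ?_
  rw [pruneProb, expect]
  by_cases hk : k = 0
  · subst hk; simp [treesOf]
  · have : (#(treesOf k) : ℝ) ≠ 0 := by exact_mod_cast (card_treesOf_pos (by omega)).ne'
    field_simp

lemma pruneProb_nonneg (n k : ℕ) : 0 ≤ pruneProb n k := by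
  unfold pruneProb; positivity

lemma pruneProb_zero (n : ℕ) : pruneProb n 0 = 0 := by simp [pruneProb, treesOf]

lemma pruneMean_congr {n : ℕ} {f g : ℕ → ℝ} (h : ∀ k, 1 ≤ k → k ≤ n → f k = g k) :
    pruneMean n f = pruneMean n g := by
  refine sum_congr rfl fun k hk => ?_
  rcases Nat.eq_zero_or_pos k with rfl | hk'
  · simp [pruneProb_zero]
  · rw [h k hk' (by simpa [Nat.lt_succ_iff] using hk)]

lemma abs_pruneMean_le {n : ℕ} {f g : ℕ → ℝ} (h : ∀ k, 1 ≤ k → k ≤ n → |f k| ≤ g k) :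
    |pruneMean n f| ≤ pruneMean n g := by
  refine (abs_sum_le_sum_abs _ _).trans (sum_le_sum fun k hk => ?_)
  rcases Nat.eq_zero_or_pos k with rfl | hk'
  · simp [pruneProb_zero]
  · rw [abs_mul, abs_of_nonneg (pruneProb_nonneg n k)]
    exact mul_le_mul_of_nonneg_left (h k hk' (by simpa [Nat.lt_succ_iff] using hk))
      (pruneProb_nonneg n k)

lemma pruneMean_add (n : ℕ) (f g : ℕ → ℝ) :
    pruneMean n (fun k => f k + g k) = pruneMean n f + pruneMean n g := by
  simp only [pruneMean, mul_add, sum_add_distrib]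

lemma pruneMean_const_mul (n : ℕ) (c : ℝ) (f : ℕ → ℝ) :
    pruneMean n (fun k => c * f k) = c * pruneMean n f := by
  simp only [pruneMean, mul_sum, mul_left_comm]

lemma pruneMean_sum {ι : Type*} (n : ℕ) (s : Finset ι) (f : ι → ℕ → ℝ) :
    pruneMean n (fun k => ∑ i ∈ s, f i k) = ∑ i ∈ s, pruneMean n (f i) := by
  simp only [pruneMean, mul_sum]
  exact sum_comm

lemma pruneMean_one {n : ℕ} (hn : 2 ≤ n) : pruneMean n (fun _ => 1) = 1 := by
  have h := expectation_prune hn (fun _ => 1)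
  rw [expectation_const (by omega)] at h
  exact (pruneMean_congr fun k hk _ => (expectation_const hk 1).symm).trans h.symm

lemma pruneWeight_succ_mul {n k : ℕ} (hk : 1 ≤ k) :
    (pruneWeight n (k + 1) : ℝ) * (4 * (2 * k) * (2 * k - 1)) =
      pruneWeight n k * ((n - 2 * k) * (n - 2 * k - 1)) := by
  obtain ⟨j, rfl⟩ : ∃ j, k = j + 1 := ⟨k - 1, by omega⟩
  by_cases h : 2 * (j + 1 + 1) ≤ n
  · obtain ⟨m, rfl⟩ : ∃ m, n = 2 * j + 2 + m + 2 := ⟨n - (2 * j + 4), by omega⟩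
    have h1 := Nat.choose_succ_right_eq (2 * j + 2 + m) (2 * j + 1)
    have h2 := Nat.choose_succ_right_eq (2 * j + 2 + m) (2 * j)
    rw [show 2 * j + 2 + m - (2 * j + 1) = m + 1 by omega] at h1
    rw [show 2 * j + 2 + m - 2 * j = m + 2 by omega] at h2
    rw [pruneWeight, pruneWeight, if_pos h, if_pos (by omega),
      show 2 * j + 2 + m + 2 - 2 * (j + 1 + 1) = m by omega,
      show 2 * j + 2 + m + 2 - 2 * (j + 1) = m + 2 by omega,
      show 2 * j + 2 + m + 2 - 2 = 2 * j + 2 + m by omega,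
      show 2 * (j + 1 + 1) - 2 = 2 * j + 1 + 1 by omega,
      show 2 * (j + 1) - 2 = 2 * j by omega]
    have h1' : ((2 * j + 2 + m).choose (2 * j + 1 + 1) : ℝ) * (2 * j + 1 + 1) =
      (2 * j + 2 + m).choose (2 * j + 1) * (m + 1) := by exact_mod_cast h1
    have h2' : ((2 * j + 2 + m).choose (2 * j + 1) : ℝ) * (2 * j + 1) =
      (2 * j + 2 + m).choose (2 * j) * (m + 2) := by exact_mod_cast h2
    push_cast
    linear_combination (4 * 2 ^ m * (2 * (j : ℝ) + 1)) * h1' + (4 * 2 ^ m * ((m : ℝ) + 1)) * h2'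
  · rw [pruneWeight, if_neg h]
    by_cases h' : 2 * (j + 1) ≤ n
    · rcases (show n = 2 * (j + 1) ∨ n = 2 * (j + 1) + 1 by omega) with rfl | rfl <;>
      · push_cast; ring
    · rw [pruneWeight, if_neg h']; simp

lemma pruneProb_succ_mul (n k : ℕ) :
    pruneProb n (k + 1) * (4 * (k + 1) * k) = pruneProb n k * ((n - 2 * k) * (n - 2 * k - 1)) := by
  rcases Nat.eq_zero_or_pos k with rfl | hk
  · simp [pruneProb_zero]
  have h1 := pruneWeight_succ_mul (n := n) hk
  have h2 : ((k : ℝ) + 1) * #(treesOf (k + 1)) = 2 * (2 * k - 1) * #(treesOf k) := by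
    have := card_treesOf_succ_mul hk
    have h3 : ((2 * k - 1 : ℕ) : ℝ) = 2 * k - 1 := by
      rw [Nat.cast_sub (by omega)]; push_cast; ring
    rw [← h3]
    exact_mod_cast this
  simp only [pruneProb]
  rw [div_mul_eq_mul_div, div_mul_eq_mul_div]
  congr 1
  linear_combination (4 * k * pruneWeight n (k + 1) : ℝ) * h2 + (#(treesOf k) : ℝ) * h1

lemma pruneMean_stein {n : ℕ} (hn : 1 ≤ n) (g : ℕ → ℝ) :
    pruneMean n (fun k => 4 * k * (k - 1) * g k) =
      pruneMean n (fun k => (n - 2 * k) * (n - 2 * k - 1) * g (k + 1)) := by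
  rw [pruneMean, pruneMean, sum_range_succ', sum_range_succ]
  have h0 : pruneProb n n = 0 := by simp [pruneProb, pruneWeight]; omega
  rw [h0, pruneProb_zero, zero_mul, zero_mul]
  congr 1
  refine sum_congr rfl fun k _ => ?_
  have := pruneProb_succ_mul n k
  push_cast
  linear_combination g (k + 1) * this

/-- The rescaled deviation of `k` from `n / 4`. -/
noncomputable def dev (n k : ℕ) : ℝ := (k - n / 4) / √n

/-- The moments of a centered normal variable of variance `v`. -/
noncomputable def gaussMoment (v : ℝ) : ℕ → ℝ
  | 0 => 1
  | 1 => 0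
  | j + 2 => (j + 1) * v * gaussMoment v j

lemma stein_recursion {n : ℕ} (hn : 2 ≤ n) (j : ℕ) :
    (4 - 6 * (√n)⁻¹ ^ 2) * pruneMean n (fun k => dev n k ^ (j + 1)) =
      (√n)⁻¹ / 2 * pruneMean n (fun k => dev n k ^ j) +
      ∑ i ∈ range j, (j.choose i : ℝ) * (√n)⁻¹ ^ (j - 1 - i) *
        ((1 / 4 - (√n)⁻¹ ^ 2 / 2) * pruneMean n (fun k => dev n k ^ i) +
          (-2 * (√n)⁻¹ + 2 * (√n)⁻¹ ^ 3) * pruneMean n (fun k => dev n k ^ (i + 1)) +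
          4 * (√n)⁻¹ ^ 2 * pruneMean n (fun k => dev n k ^ (i + 2))) := by
  have h := pruneMean_stein (n := n) (by omega) (fun k => dev n k ^ j)
  simp only [← pruneMean_const_mul, ← pruneMean_add, ← pruneMean_sum]
  have hx : 0 < √(n : ℝ) := Real.sqrt_pos.mpr (by positivity)
  set x := √(n : ℝ) with hxdef
  have hn' : (n : ℝ) = x ^ 2 := (Real.sq_sqrt (by positivity)).symm
  rw [← sub_eq_zero] at h ⊢
  have h2 : ∀ f g : ℕ → ℝ, pruneMean n f - pruneMean n g = pruneMean n (fun k => f k - g k) := by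
    intro f g; simp only [pruneMean, mul_sub, sum_sub_distrib]
  rw [h2] at h ⊢
  have h3 : pruneMean n (fun k => x⁻¹ ^ 3 * (4 * k * (k - 1) * dev n k ^ j -
      (n - 2 * k) * (n - 2 * k - 1) * dev n (k + 1) ^ j)) = 0 := by
    rw [pruneMean_const_mul, h, mul_zero]
  rw [← h3]
  refine pruneMean_congr fun k _ _ => ?_
  have hk : (k : ℝ) = x ^ 2 / 4 + x * dev n k := by
    rw [dev, ← hxdef, hn']; field_simp; ring
  have hk1 : dev n (k + 1) = dev n k + x⁻¹ := by
    rw [dev, dev, ← hxdef]; push_cast; field_simp; ring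
  rw [hk1, hk, hn']
  set z := dev n k
  have hbin : x⁻¹ * ∑ i ∈ range j, (j.choose i : ℝ) * x⁻¹ ^ (j - 1 - i) * z ^ i =
      (z + x⁻¹) ^ j - z ^ j := by
    rw [add_pow, sum_range_succ]
    simp only [Nat.sub_self, pow_zero, Nat.choose_self, Nat.cast_one, mul_one, add_sub_cancel_right]
    rw [mul_sum]
    refine sum_congr rfl fun i hi => ?_
    rw [mem_range] at hi
    rw [show j - i = j - 1 - i + 1 by omega]
    ring
  have hfac : ∑ i ∈ range j, (j.choose i : ℝ) * x⁻¹ ^ (j - 1 - i) *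
        ((1 / 4 - x⁻¹ ^ 2 / 2) * z ^ i + (-2 * x⁻¹ + 2 * x⁻¹ ^ 3) * z ^ (i + 1) +
          4 * x⁻¹ ^ 2 * z ^ (i + 2)) =
      (1 / 4 - x⁻¹ ^ 2 / 2 + (-2 * x⁻¹ + 2 * x⁻¹ ^ 3) * z + 4 * x⁻¹ ^ 2 * z ^ 2) *
        (x * ((z + x⁻¹) ^ j - z ^ j)) := by
    rw [← hbin, ← mul_assoc x, mul_inv_cancel₀ hx.ne', one_mul, mul_sum]
    refine sum_congr rfl fun i _ => ?_
    ring
  rw [hfac]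
  field_simp
  ring

lemma tendsto_inv_sqrt : Tendsto (fun n : ℕ => (√(n : ℝ))⁻¹) atTop (𝓝 0) :=
  tendsto_inv_atTop_zero.comp (Real.tendsto_sqrt_atTop.comp tendsto_natCast_atTop_atTop)

lemma tendsto_moment (j : ℕ) :
    Tendsto (fun n => pruneMean n (fun k => dev n k ^ j)) atTop (𝓝 (gaussMoment (1 / 16) j)) := by
  have he := tendsto_inv_sqrt
  induction j using Nat.strong_induction_on with
  | _ j ih =>
  match j with
  | 0 =>
    refine tendsto_const_nhds.congr' ?_
    filter_upwards [eventually_ge_atTop 2] with n hn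
    simp only [pow_zero, gaussMoment, pruneMean_one hn]
  | 1 =>
    have h1 : Tendsto (fun n : ℕ => ((√(n : ℝ))⁻¹ / 2 * pruneMean n (fun k => dev n k ^ 0)) /
        (4 - 6 * (√(n : ℝ))⁻¹ ^ 2)) atTop (𝓝 ((0 / 2 * gaussMoment (1 / 16) 0) / (4 - 6 * 0 ^ 2))) :=
      ((he.div_const 2).mul (ih 0 (by omega))).div
        (tendsto_const_nhds.sub ((he.pow 2).const_mul 6)) (by norm_num)
    have hden : ∀ᶠ n : ℕ in atTop, 4 - 6 * (√(n : ℝ))⁻¹ ^ 2 ≠ 0 :=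
      (tendsto_const_nhds.sub ((he.pow 2).const_mul 6)).eventually_ne (by norm_num)
    simp only [zero_div, zero_mul] at h1
    refine h1.congr' ?_
    filter_upwards [eventually_ge_atTop 2, hden] with n hn hd
    have := stein_recursion hn 0
    rw [range_zero, sum_empty, add_zero, zero_add] at this
    rw [div_eq_iff hd]
    linear_combination -this
  | m + 2 =>
    have hden' : Tendsto (fun n : ℕ => 4 - (6 + 4 * ((m : ℝ) + 1)) * (√(n : ℝ))⁻¹ ^ 2) atTop
        (𝓝 (4 - (6 + 4 * ((m : ℝ) + 1)) * 0 ^ 2)) :=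
      tendsto_const_nhds.sub ((he.pow 2).const_mul _)
    have hden := hden'.eventually_ne (by norm_num : 4 - (6 + 4 * ((m : ℝ) + 1)) * 0 ^ 2 ≠ 0)
    have hc : Tendsto (fun n : ℕ => 1 / 4 - (√(n : ℝ))⁻¹ ^ 2 / 2) atTop
        (𝓝 (1 / 4 - 0 ^ 2 / 2)) := tendsto_const_nhds.sub ((he.pow 2).div_const 2)
    have hd : Tendsto (fun n : ℕ => -2 * (√(n : ℝ))⁻¹ + 2 * (√(n : ℝ))⁻¹ ^ 3) atTop
        (𝓝 (-2 * 0 + 2 * 0 ^ 3)) := (he.const_mul (-2)).add ((he.pow 3).const_mul 2)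
    have hq : Tendsto (fun n : ℕ => 4 * (√(n : ℝ))⁻¹ ^ 2) atTop (𝓝 (4 * 0 ^ 2)) :=
      (he.pow 2).const_mul 4
    have hs : Tendsto (fun n : ℕ => ∑ i ∈ range m,
        ((m + 1).choose i : ℝ) * (√n)⁻¹ ^ (m + 1 - 1 - i) *
        ((1 / 4 - (√n)⁻¹ ^ 2 / 2) * pruneMean n (fun k => dev n k ^ i) +
          (-2 * (√n)⁻¹ + 2 * (√n)⁻¹ ^ 3) * pruneMean n (fun k => dev n k ^ (i + 1)) +
          4 * (√n)⁻¹ ^ 2 * pruneMean n (fun k => dev n k ^ (i + 2)))) atTop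
        (𝓝 (∑ i ∈ range m, ((m + 1).choose i : ℝ) * 0 ^ (m + 1 - 1 - i) *
        ((1 / 4 - 0 ^ 2 / 2) * gaussMoment (1 / 16) i +
          (-2 * 0 + 2 * 0 ^ 3) * gaussMoment (1 / 16) (i + 1) +
          4 * 0 ^ 2 * gaussMoment (1 / 16) (i + 2)))) := by
      refine tendsto_finsetSum _ fun i hi => ?_
      rw [mem_range] at hi
      exact ((he.pow _).const_mul _).mul (((hc.mul (ih i (by omega))).add
        (hd.mul (ih (i + 1) (by omega)))).add (hq.mul (ih (i + 2) (by omega))))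
    have hs0 : ∑ i ∈ range m, ((m + 1).choose i : ℝ) * 0 ^ (m + 1 - 1 - i) *
        ((1 / 4 - 0 ^ 2 / 2) * gaussMoment (1 / 16) i +
          (-2 * 0 + 2 * 0 ^ 3) * gaussMoment (1 / 16) (i + 1) +
          4 * 0 ^ 2 * gaussMoment (1 / 16) (i + 2)) = 0 := by
      refine sum_eq_zero fun i hi => ?_
      rw [mem_range] at hi
      rw [zero_pow (by omega)]; ring
    rw [hs0] at hs
    have h1 := ((((he.div_const 2).mul (ih (m + 1) (by omega))).add hs).add
      (((hc.mul (ih m (by omega))).add (hd.mul (ih (m + 1) (by omega)))).const_mul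
        ((m : ℝ) + 1))).div hden' (by norm_num)
    have hlim : gaussMoment (1 / 16) (m + 2) =
        (0 / 2 * gaussMoment (1 / 16) (m + 1) + 0 + (m + 1) *
          ((1 / 4 - 0 ^ 2 / 2) * gaussMoment (1 / 16) m +
            (-2 * 0 + 2 * 0 ^ 3) * gaussMoment (1 / 16) (m + 1))) /
          (4 - (6 + 4 * ((m : ℝ) + 1)) * 0 ^ 2) := by
      rw [gaussMoment]; ring
    rw [hlim]
    refine h1.congr' ?_
    filter_upwards [eventually_ge_atTop 2, hden] with n hn hd
    have h2 := stein_recursion hn (m + 1)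
    rw [sum_range_succ, Nat.choose_succ_self_right, show m + 1 - 1 - m = 0 by omega] at h2
    rw [Pi.div_apply, div_eq_iff hd]
    push_cast at h2
    simp only [add_tsub_cancel_right]
    linear_combination -h2

lemma gaussMoment_nonneg {v : ℝ} (hv : 0 ≤ v) (j : ℕ) : 0 ≤ gaussMoment v j := by
  induction j using Nat.strong_induction_on with
  | _ j ih =>
  match j with
  | 0 => simp [gaussMoment]
  | 1 => simp [gaussMoment]
  | j + 2 =>
    have := ih j (by omega)
    rw [gaussMoment]; positivity

/-- Pairs `(n, k)` with `n → ∞` and `k / n → 1 / 4`. -/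
noncomputable def quarterFilter : Filter (ℕ × ℕ) :=
  comap (fun p => p.1) atTop ⊓ comap (fun p => (p.2 : ℝ) / p.1) (𝓝 (1 / 4))

lemma tendsto_fst_quarterFilter : Tendsto (fun p : ℕ × ℕ => p.1) quarterFilter atTop :=
  tendsto_comap.mono_left inf_le_left

lemma tendsto_div_quarterFilter :
    Tendsto (fun p : ℕ × ℕ => (p.2 : ℝ) / p.1) quarterFilter (𝓝 (1 / 4)) :=
  tendsto_comap.mono_left inf_le_right

lemma tendsto_snd_quarterFilter : Tendsto (fun p : ℕ × ℕ => p.2) quarterFilter atTop := by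
  rw [← tendsto_natCast_atTop_iff (R := ℝ)]
  have h1 : Tendsto (fun p : ℕ × ℕ => (p.1 : ℝ)) quarterFilter atTop :=
    tendsto_natCast_atTop_atTop.comp tendsto_fst_quarterFilter
  refine (tendsto_div_quarterFilter.pos_mul_atTop (by norm_num) h1).congr' ?_
  filter_upwards [tendsto_fst_quarterFilter.eventually_ge_atTop 1] with p hp
  have : (p.1 : ℝ) ≠ 0 := by positivity
  field_simp

lemma exists_of_tendsto_quarterFilter {a : ℕ → ℕ → ℝ} {L : ℝ}
    (ha : Tendsto (fun p : ℕ × ℕ => a p.1 p.2) quarterFilter (𝓝 L)) {ε : ℝ} (hε : 0 < ε) :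
    ∃ δ > 0, ∃ N : ℕ, ∀ n ≥ N, ∀ k : ℕ, |(k : ℝ) / n - 1 / 4| < δ → |a n k - L| < ε := by
  have h := ha.eventually (Metric.ball_mem_nhds L hε)
  have hb : quarterFilter.HasBasis (fun q : ℕ × ℝ => True ∧ 0 < q.2) fun q =>
      (fun p : ℕ × ℕ => p.1) ⁻¹' Set.Ici q.1 ∩
        (fun p : ℕ × ℕ => (p.2 : ℝ) / p.1) ⁻¹' Metric.ball (1 / 4) q.2 :=
    (atTop_basis.comap _).inf (Metric.nhds_basis_ball.comap _)
  obtain ⟨⟨N, δ⟩, ⟨-, hδ⟩, h⟩ := hb.eventually_iff.mp h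
  refine ⟨δ, hδ, N, fun n hn k hk => ?_⟩
  have := h (x := (n, k)) ⟨hn, by simpa [Real.dist_eq] using hk⟩
  simpa [Real.dist_eq] using this

lemma abs_le_one_add_sq_pow (z : ℝ) (j : ℕ) : |z ^ j| ≤ 1 + z ^ (2 * j) := by
  have h : z ^ (2 * j) = |z ^ j| ^ 2 := by rw [sq_abs, ← pow_mul, mul_comm]
  rw [h]
  nlinarith [sq_nonneg (|z ^ j| - 1), abs_nonneg (z ^ j)]

/-- Far from `k / n = 1 / 4`, the rescaled deviation is at least of order `√n`. -/
lemma far_bound {n k : ℕ} {δ b B : ℝ} (hn : 1 ≤ n) (hδ : 0 < δ) (j t : ℕ) (hB : 0 ≤ B)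
    (hb : |b| ≤ B * n ^ t) (hk : δ ≤ |(k : ℝ) / n - 1 / 4|) :
    |dev n k ^ j * b| ≤ (n : ℝ)⁻¹ * (B / δ ^ (2 * (t + 1)) *
      (dev n k ^ (2 * (t + 1)) + dev n k ^ (2 * (t + 1 + j)))) := by
  have hn0 : (0 : ℝ) < n := by positivity
  have hx : 0 < √(n : ℝ) := Real.sqrt_pos.mpr hn0
  have hsq : √(n : ℝ) ^ 2 = n := Real.sq_sqrt hn0.le
  have e : (k : ℝ) / n - 1 / 4 = dev n k / √n := by
    rw [dev, div_div, ← sq, hsq]; field_simp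
  rw [e, abs_div, abs_of_pos hx, le_div_iff₀ hx] at hk
  have h1 : δ ^ 2 * n ≤ dev n k ^ 2 := by
    rw [← hsq, ← mul_pow, ← sq_abs (dev n k)]
    gcongr
  have h2 : (δ ^ 2 * n) ^ (t + 1) ≤ (dev n k ^ 2) ^ (t + 1) := by gcongr
  have h3 : (n : ℝ) ^ t ≤ (n : ℝ)⁻¹ * (dev n k ^ (2 * (t + 1)) / δ ^ (2 * (t + 1))) := by
    rw [inv_mul_eq_div, le_div_iff₀ hn0, le_div_iff₀ (by positivity), pow_mul, pow_mul]
    calc (n : ℝ) ^ t * n * (δ ^ 2) ^ (t + 1) = (δ ^ 2 * n) ^ (t + 1) := by ring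
      _ ≤ _ := h2
  have h4 := abs_le_one_add_sq_pow (dev n k) j
  have h5 : 0 ≤ dev n k ^ (2 * j) := by rw [pow_mul]; positivity
  rw [abs_mul]
  calc |dev n k ^ j| * |b| ≤ (1 + dev n k ^ (2 * j)) * (B * n ^ t) := by gcongr
    _ ≤ (1 + dev n k ^ (2 * j)) *
        (B * ((n : ℝ)⁻¹ * (dev n k ^ (2 * (t + 1)) / δ ^ (2 * (t + 1))))) := by gcongr
    _ = _ := by ring

/-- Concentration: a polynomially bounded factor may be replaced by its limit at `k / n = 1 / 4`. -/
lemma tendsto_pruneMean_dev_mul {a : ℕ → ℕ → ℝ} {B L : ℝ} (j t : ℕ)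
    (hB : ∀ n k, 1 ≤ k → k ≤ n → |a n k| ≤ B * n ^ t)
    (ha : Tendsto (fun p : ℕ × ℕ => a p.1 p.2) quarterFilter (𝓝 L)) :
    Tendsto (fun n => pruneMean n (fun k => dev n k ^ j * a n k)) atTop
      (𝓝 (gaussMoment (1 / 16) j * L)) := by
  have hB0 : 0 ≤ B := by
    have := (abs_nonneg _).trans (hB 1 1 le_rfl le_rfl)
    simpa using this
  have hzero : Tendsto (fun n => pruneMean n (fun k => dev n k ^ j * (a n k - L))) atTop
      (𝓝 0) := by
    rw [Metric.tendsto_atTop']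
    intro η hη
    have hμ : 0 ≤ gaussMoment (1 / 16) (2 * j) := gaussMoment_nonneg (by norm_num) _
    set ε := η / (2 + gaussMoment (1 / 16) (2 * j)) with hε_def
    have hε : 0 < ε := by positivity
    obtain ⟨δ, hδ, N, hN⟩ := exists_of_tendsto_quarterFilter ha hε
    set C := (B + |L|) / δ ^ (2 * (t + 1))
    have hlim : Tendsto (fun n : ℕ => ε * (1 + pruneMean n (fun k => dev n k ^ (2 * j))) +
        (n : ℝ)⁻¹ * (C * (pruneMean n (fun k => dev n k ^ (2 * (t + 1))) +
          pruneMean n (fun k => dev n k ^ (2 * (t + 1 + j)))))) atTop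
        (𝓝 (ε * (1 + gaussMoment (1 / 16) (2 * j)) +
          0 * (C * (gaussMoment (1 / 16) (2 * (t + 1)) +
            gaussMoment (1 / 16) (2 * (t + 1 + j)))))) :=
      (((tendsto_moment _).const_add 1).const_mul ε).add
        ((tendsto_inv_atTop_zero.comp tendsto_natCast_atTop_atTop).mul
          (((tendsto_moment _).add (tendsto_moment _)).const_mul C))
    have hlt : ε * (1 + gaussMoment (1 / 16) (2 * j)) +
          0 * (C * (gaussMoment (1 / 16) (2 * (t + 1)) +
            gaussMoment (1 / 16) (2 * (t + 1 + j)))) < η := by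
      have : η = ε * (2 + gaussMoment (1 / 16) (2 * j)) := by
        rw [hε_def]; field_simp
      linarith
    obtain ⟨M, hM⟩ := eventually_atTop.mp (hlim.eventually_lt_const hlt)
    refine ⟨max (max N M) 2, fun n hn => ?_⟩
    have hn2 : 2 ≤ n := by have := le_max_right (max N M) 2; omega
    have hnN : N ≤ n := by
      have := le_max_left (max N M) 2; have := le_max_left N M; omega
    have hnM : M ≤ n := by
      have := le_max_left (max N M) 2; have := le_max_right N M; omega
    rw [Real.dist_eq, sub_zero]
    refine lt_of_le_of_lt ?_ (hM n hnM)
    rw [← pruneMean_one hn2, ← pruneMean_add, ← pruneMean_add, ← pruneMean_const_mul,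
      ← pruneMean_const_mul, ← pruneMean_const_mul, ← pruneMean_add]
    refine abs_pruneMean_le fun k hk1 hk2 => ?_
    have he : ∀ i, 0 ≤ dev n k ^ (2 * i) := fun i => by rw [pow_mul]; positivity
    rcases lt_or_ge |(k : ℝ) / n - 1 / 4| δ with h | h
    · have h1 := hN n hnN k h
      have h2 := abs_le_one_add_sq_pow (dev n k) j
      have h3 : 0 ≤ (n : ℝ)⁻¹ * (C * (dev n k ^ (2 * (t + 1)) + dev n k ^ (2 * (t + 1 + j)))) := by
        have := he (t + 1)
        have := he (t + 1 + j)
        positivity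
      have h4 : |dev n k ^ j * (a n k - L)| ≤ (1 + dev n k ^ (2 * j)) * ε := by
        rw [abs_mul]
        have := he j
        gcongr
      linarith
    · have hb : |a n k - L| ≤ (B + |L|) * n ^ t := by
        have h1 : (1 : ℝ) ≤ (n : ℝ) ^ t := one_le_pow₀ (by exact_mod_cast (by omega : 1 ≤ n))
        have h2 := abs_sub (a n k) L
        have h3 := hB n k hk1 hk2
        have h4 : |L| ≤ |L| * n ^ t := le_mul_of_one_le_right (abs_nonneg L) h1
        linarith
      have h1 := far_bound (by omega) hδ j t (by positivity) hb h
      have h2 : 0 ≤ ε * (1 + dev n k ^ (2 * j)) := by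
        have := he j
        positivity
      exact h1.trans (le_add_of_nonneg_left h2)
  have h := ((tendsto_moment j).mul_const L).add hzero
  rw [add_zero] at h
  refine h.congr fun n => ?_
  rw [mul_comm, ← pruneMean_const_mul, ← pruneMean_add]
  congr 1
  ext k
  ring

lemma gaussMoment_add (u v : ℝ) (j : ℕ) :
    gaussMoment (u + v) j =
      ∑ p ∈ antidiagonal j, (j.choose p.1 : ℝ) * (gaussMoment u p.1 * gaussMoment v p.2) := by
  have hstep : ∀ (u v : ℝ) (j : ℕ),
      ∑ p ∈ antidiagonal (j + 1), ((j + 1).choose p.1 : ℝ) *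
        (gaussMoment u (p.1 + 1) * gaussMoment v p.2) =
      (j + 1) * u * ∑ p ∈ antidiagonal j, (j.choose p.1 : ℝ) *
        (gaussMoment u p.1 * gaussMoment v p.2) := by
    intro u v j
    rw [Finset.Nat.antidiagonal_succ, sum_cons, sum_map, mul_sum]
    simp only [Function.Embedding.prodMap, Function.Embedding.coeFn_mk, Prod.map,
      Function.Embedding.refl_apply, zero_add, Nat.succ_eq_add_one]
    rw [show gaussMoment u 1 = 0 by simp [gaussMoment]]
    simp only [zero_mul, mul_zero, zero_add]
    refine sum_congr rfl fun p _ => ?_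
    rw [gaussMoment]
    have : ((j : ℝ) + 1) * j.choose p.1 = (j + 1).choose (p.1 + 1) * (p.1 + 1) := by
      exact_mod_cast Nat.add_one_mul_choose_eq j p.1
    linear_combination (-u * gaussMoment u p.1 * gaussMoment v p.2) * this
  induction j using Nat.strong_induction_on with
  | _ j ih =>
  match j with
  | 0 => simp [gaussMoment]
  | 1 => simp [gaussMoment, Finset.Nat.antidiagonal_succ]
  | j + 2 =>
    have h := sum_antidiagonal_choose_succ_mul
      (fun a b => gaussMoment u a * gaussMoment v b) (j + 1)
    rw [h, gaussMoment, ih j (by omega)]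
    have h2 := hstep u v j
    have h3 := hstep v u j
    have swap : ∀ (m : ℕ) (f : ℕ → ℕ → ℝ), ∑ p ∈ antidiagonal m, f p.1 p.2 =
        ∑ p ∈ antidiagonal m, f p.2 p.1 := fun m f =>
      (Finset.Nat.sum_antidiagonal_swap (f := fun p : ℕ × ℕ => f p.1 p.2)).symm
    have h4 : ∑ p ∈ antidiagonal (j + 1), ((j + 1).choose p.2 : ℝ) *
        (gaussMoment u (p.1 + 1) * gaussMoment v p.2) =
        ∑ p ∈ antidiagonal (j + 1), ((j + 1).choose p.1 : ℝ) *
        (gaussMoment u (p.1 + 1) * gaussMoment v p.2) := by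
      refine sum_congr rfl fun p hp => ?_
      rw [Nat.choose_symm_of_eq_add (mem_antidiagonal.mp hp).symm]
    have h5 : ∑ p ∈ antidiagonal (j + 1), ((j + 1).choose p.1 : ℝ) *
        (gaussMoment u p.1 * gaussMoment v (p.2 + 1)) =
        ∑ p ∈ antidiagonal (j + 1), ((j + 1).choose p.1 : ℝ) *
        (gaussMoment v (p.1 + 1) * gaussMoment u p.2) := by
      rw [swap _ (fun a b => ((j + 1).choose a : ℝ) * (gaussMoment u a * gaussMoment v (b + 1)))]
      refine sum_congr rfl fun p hp => ?_
      rw [Nat.choose_symm_of_eq_add (mem_antidiagonal.mp hp).symm, mul_comm (gaussMoment u _)]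
    have h6 : ∑ p ∈ antidiagonal j, (j.choose p.1 : ℝ) * (gaussMoment v p.1 * gaussMoment u p.2) =
        ∑ p ∈ antidiagonal j, (j.choose p.1 : ℝ) * (gaussMoment u p.1 * gaussMoment v p.2) := by
      rw [swap _ (fun a b => (j.choose a : ℝ) * (gaussMoment v a * gaussMoment u b))]
      refine sum_congr rfl fun p hp => ?_
      rw [Nat.choose_symm_of_eq_add (mem_antidiagonal.mp hp).symm, mul_comm (gaussMoment u _)]
    rw [h4, h5, h2, h3, h6]
    ring

lemma gaussMoment_sq_mul (c v : ℝ) (j : ℕ) :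
    gaussMoment (c ^ 2 * v) j = c ^ j * gaussMoment v j := by
  induction j using Nat.strong_induction_on with
  | _ j ih =>
  match j with
  | 0 => simp [gaussMoment]
  | 1 => simp [gaussMoment]
  | j + 2 => rw [gaussMoment, gaussMoment, ih j (by omega)]; ring

lemma gaussMoment_two_mul (v : ℝ) (s : ℕ) :
    gaussMoment v (2 * s) = (Nat.doubleFactorial (2 * s - 1) : ℝ) * v ^ s := by
  induction s with
  | zero => simp [gaussMoment]
  | succ s ih =>
    rw [show 2 * (s + 1) = 2 * s + 2 by ring, gaussMoment, ih]
    have : Nat.doubleFactorial (2 * s + 2 - 1) =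
        (2 * s + 1) * Nat.doubleFactorial (2 * s - 1) := by
      cases s with
      | zero => simp
      | succ s =>
        rw [show 2 * (s + 1) + 2 - 1 = 2 * s + 1 + 2 by omega, Nat.doubleFactorial_add_two,
          show 2 * (s + 1) - 1 = 2 * s + 1 by omega]
        ring
    rw [this]
    push_cast
    ring

lemma gaussMoment_zero_var (j : ℕ) : gaussMoment 0 j = 0 ^ j := by
  match j with
  | 0 => simp [gaussMoment]
  | 1 => simp [gaussMoment]
  | j + 2 => simp [gaussMoment]

/-- The moments of the rescaled deviation of the proportion of branches of order `r + 1`. -/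
noncomputable def branchMoment (r j n : ℕ) : ℝ :=
  expect n fun τ => (√n * ((branches (1 + r) τ : ℝ) / n - 1 / 4 ^ r)) ^ j

lemma branchMoment_succ (r j : ℕ) {n : ℕ} (hn : 2 ≤ n) :
    branchMoment (r + 1) j n = ∑ m ∈ range (j + 1), ((j.choose m : ℝ) * (1 / 4 ^ r) ^ (j - m)) *
      pruneMean n (fun k => dev n k ^ (j - m) * (√((k : ℝ) / n) ^ m * branchMoment r m k)) := by
  have h := expectation_prune hn (fun σ =>
    (√n * ((branches (1 + r) σ : ℝ) / n - 1 / 4 ^ (r + 1))) ^ j)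
  refine Eq.trans (expectation_congr fun τ hτ => ?_) (h.trans ?_)
  · have hl : τ ≠ leaf := by rintro rfl; simp [magnitude] at hτ; omega
    rw [← branches_succ (by omega) hl, ← add_assoc]
  simp only [← pruneMean_const_mul, ← pruneMean_sum]
  refine pruneMean_congr fun k hk _ => ?_
  simp only [branchMoment, ← mul_assoc]
  rw [← expectation_sum_mul]
  refine expectation_congr fun σ _ => ?_
  have hx : 0 < √(n : ℝ) := Real.sqrt_pos.mpr (by positivity)
  have hy : 0 < √(k : ℝ) := Real.sqrt_pos.mpr (by positivity)
  have hx2 : (n : ℝ) = √n ^ 2 := (Real.sq_sqrt (by positivity)).symm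
  have hy2 : (k : ℝ) = √k ^ 2 := (Real.sq_sqrt (by positivity)).symm
  have e : √(n : ℝ) * ((branches (1 + r) σ : ℝ) / n - 1 / 4 ^ (r + 1)) =
      √((k : ℝ) / n) * (√k * ((branches (1 + r) σ : ℝ) / k - 1 / 4 ^ r)) + 1 / 4 ^ r * dev n k := by
    rw [dev, Real.sqrt_div (by positivity), pow_succ]
    generalize √(n : ℝ) = x at *
    generalize √(k : ℝ) = y at *
    rw [hx2, hy2]
    field_simp
    ring
  rw [e, add_pow]
  refine sum_congr rfl fun m _ => ?_
  rw [mul_pow, mul_pow]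
  ring

lemma tendsto_branchMoment (r j : ℕ) :
    Tendsto (branchMoment r j) atTop
      (𝓝 (gaussMoment (((4 : ℝ) ^ r - 1) / (3 * 16 ^ r)) j)) := by
  induction r generalizing j with
  | zero =>
    rw [pow_zero, sub_self, zero_div, gaussMoment_zero_var]
    refine tendsto_const_nhds.congr' ?_
    filter_upwards [eventually_ge_atTop 1] with n hn
    rw [branchMoment, ← expectation_const hn (0 ^ j)]
    refine expectation_congr fun τ hτ => ?_
    have : (n : ℝ) ≠ 0 := by positivity
    rw [add_zero, branches_one, hτ, div_self this]
    simp
  | succ r ih =>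
    have hlim : gaussMoment (((4 : ℝ) ^ (r + 1) - 1) / (3 * 16 ^ (r + 1))) j =
        ∑ m ∈ range (j + 1), ((j.choose m : ℝ) * (1 / 4 ^ r) ^ (j - m)) *
          (gaussMoment (1 / 16) (j - m) *
            ((1 / 2) ^ m * gaussMoment (((4 : ℝ) ^ r - 1) / (3 * 16 ^ r)) m)) := by
      have h16 : (16 : ℝ) ^ r = (4 ^ r) ^ 2 := by rw [← pow_mul, mul_comm, pow_mul]; norm_num
      have e : ((4 : ℝ) ^ (r + 1) - 1) / (3 * 16 ^ (r + 1)) =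
          (1 / 2) ^ 2 * (((4 : ℝ) ^ r - 1) / (3 * 16 ^ r)) + (1 / 4 ^ r) ^ 2 * (1 / 16) := by
        rw [pow_succ 16, h16]
        field_simp
        ring
      rw [e, gaussMoment_add, Finset.Nat.sum_antidiagonal_eq_sum_range_succ_mk]
      refine sum_congr rfl fun m _ => ?_
      rw [gaussMoment_sq_mul, gaussMoment_sq_mul]
      ring
    rw [hlim]
    have hsum : Tendsto (fun n => ∑ m ∈ range (j + 1),
        ((j.choose m : ℝ) * (1 / 4 ^ r) ^ (j - m)) * pruneMean n (fun k =>
          dev n k ^ (j - m) * (√((k : ℝ) / n) ^ m * branchMoment r m k))) atTop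
        (𝓝 (∑ m ∈ range (j + 1), ((j.choose m : ℝ) * (1 / 4 ^ r) ^ (j - m)) *
          (gaussMoment (1 / 16) (j - m) *
            ((1 / 2) ^ m * gaussMoment (((4 : ℝ) ^ r - 1) / (3 * 16 ^ r)) m)))) := by
      refine tendsto_finsetSum _ fun m _ => Tendsto.const_mul _ ?_
      obtain ⟨B, hB⟩ := (ih m).abs.bddAbove_range
      have hB' : ∀ k, |branchMoment r m k| ≤ B := fun k => hB ⟨k, rfl⟩
      refine tendsto_pruneMean_dev_mul (B := B) (a := fun n k =>
        √((k : ℝ) / n) ^ m * branchMoment r m k) (j - m) 0 ?_ ?_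
      · intro n k hk hkn
        have h1 : √((k : ℝ) / n) ^ m ≤ 1 := by
          refine pow_le_one₀ (Real.sqrt_nonneg _) (Real.sqrt_le_one.mpr ?_)
          exact div_le_one_of_le₀ (by exact_mod_cast hkn) (by positivity)
        rw [pow_zero, mul_one, abs_mul, abs_of_nonneg (by positivity)]
        calc _ ≤ 1 * |branchMoment r m k| := by gcongr
          _ ≤ B := by rw [one_mul]; exact hB' k
      · have h1 := (Real.continuous_sqrt.tendsto _).comp tendsto_div_quarterFilter
        have h2 : √(1 / 4 : ℝ) = 1 / 2 := by
          rw [show (1 / 4 : ℝ) = (1 / 2) ^ 2 by norm_num, Real.sqrt_sq (by norm_num)]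
        rw [h2] at h1
        exact (h1.pow m).mul ((ih m).comp tendsto_snd_quarterFilter)
    refine hsum.congr' ?_
    filter_upwards [eventually_ge_atTop 2] with n hn
    exact (branchMoment_succ r j hn).symm

/-- The even moments of the deviation of the ratio of branch numbers. -/
noncomputable def ratioMoment (q r s n : ℕ) : ℝ :=
  expect n fun τ => ((branches (q + r) τ : ℝ) / (branches q τ : ℝ) - 1 / 4 ^ r) ^ (2 * s)

lemma ratioMoment_succ {q : ℕ} (hq : 1 ≤ q) (r s : ℕ) {n : ℕ} (hn : 2 ≤ n) :
    ratioMoment (q + 1) r s n = pruneMean n (ratioMoment q r s) := by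
  have h := expectation_prune hn (fun σ =>
    ((branches (q + r) σ : ℝ) / (branches q σ : ℝ) - 1 / 4 ^ r) ^ (2 * s))
  refine Eq.trans (expectation_congr fun τ hτ => ?_) h
  have hl : τ ≠ leaf := by rintro rfl; simp [magnitude] at hτ; omega
  rw [← branches_succ hq hl, ← branches_succ (by omega) hl, add_right_comm]

lemma tendsto_ratioMoment (q r s : ℕ) :
    Tendsto (fun n : ℕ => (n : ℝ) ^ s * ratioMoment (q + 1) r s n) atTop
      (𝓝 (4 ^ (s * q) * ((Nat.doubleFactorial (2 * s - 1) : ℝ) *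
        (((4 : ℝ) ^ r - 1) / (3 * 16 ^ r)) ^ s))) := by
  induction q with
  | zero =>
    rw [mul_zero, pow_zero, one_mul, ← gaussMoment_two_mul]
    refine (tendsto_branchMoment r (2 * s)).congr fun n => ?_
    rw [branchMoment, ratioMoment, ← expectation_const_mul]
    refine expectation_congr fun τ hτ => ?_
    rw [zero_add, branches_one, hτ, mul_pow, pow_mul, Real.sq_sqrt (by positivity)]
  | succ q ih =>
    set c := (Nat.doubleFactorial (2 * s - 1) : ℝ) * (((4 : ℝ) ^ r - 1) / (3 * 16 ^ r)) ^ s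
    obtain ⟨B, hB⟩ := ih.abs.bddAbove_range
    have hB' : ∀ k : ℕ, |(k : ℝ) ^ s * ratioMoment (q + 1) r s k| ≤ B := fun k => hB ⟨k, rfl⟩
    have h := tendsto_pruneMean_dev_mul (B := B) (L := ((1 / 4 : ℝ)⁻¹) ^ s * (4 ^ (s * q) * c))
      (a := fun n k => (n : ℝ) ^ s * ratioMoment (q + 1) r s k) 0 s ?_ ?_
    · have e : gaussMoment (1 / 16) 0 * (((1 / 4 : ℝ)⁻¹) ^ s * (4 ^ (s * q) * c)) =
          4 ^ (s * (q + 1)) * c := by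
        rw [gaussMoment, mul_add, pow_add]; norm_num; ring
      rw [e] at h
      refine h.congr' ?_
      filter_upwards [eventually_ge_atTop 2] with n hn
      simp only [pow_zero, one_mul, pruneMean_const_mul]
      rw [ratioMoment_succ (by omega) r s hn]
    · intro n k hk _
      have h1 : (1 : ℝ) ≤ (k : ℝ) ^ s := one_le_pow₀ (by exact_mod_cast hk)
      have h2 := hB' k
      rw [abs_mul, abs_of_nonneg (by positivity)] at h2 ⊢
      have h3 : |ratioMoment (q + 1) r s k| ≤ B :=
        (le_mul_of_one_le_left (abs_nonneg _) h1).trans h2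
      rw [mul_comm]
      gcongr
    · have h1 := ((tendsto_div_quarterFilter.inv₀ (by norm_num)).pow s).mul
        (ih.comp tendsto_snd_quarterFilter)
      refine h1.congr' ?_
      filter_upwards [tendsto_snd_quarterFilter.eventually_ge_atTop 1] with p hp
      have : (p.2 : ℝ) ≠ 0 := by positivity
      simp only [Function.comp_apply, inv_div, div_pow]
      field_simp

end

/-- Even moments of the general ratio deviation (Lemma 5, even case): for `q, r ≥ 1`, `s ≥ 0`,
`⟨(S_{q+r,n}/S_{q,n} − 1/4^r)^{2s}⟩ ∼ 4^{s(q−1)} ((2s−1)!!/4^{2sr}) ((4^r−1)/3)^s n^{−s}`.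
The ratio is `0` on trees with `S_{q,n} = 0`. -/
theorem even_moments_general_ratio (q r s : ℕ) (hq : 1 ≤ q) (hr : 1 ≤ r) :
    Tendsto (fun n : ℕ =>
        expect n (fun τ =>
            ((BinTree.branches (q+r) τ : ℝ) / (BinTree.branches q τ : ℝ) - 1 / 4 ^ r) ^ (2*s))
          / ((4 : ℝ) ^ (s*(q-1)) * ((Nat.doubleFactorial (2*s - 1) : ℝ) / 4 ^ (2*s*r))
              * (((4 : ℝ) ^ r - 1) / 3) ^ s * (n : ℝ) ^ (-(s : ℤ))))
      atTop (𝓝 1) := by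
  obtain ⟨p, rfl⟩ : ∃ p, q = p + 1 := ⟨q - 1, by omega⟩
  have h := tendsto_ratioMoment p r s
  set D : ℝ := (4 : ℝ) ^ (s * (p + 1 - 1)) *
    ((Nat.doubleFactorial (2 * s - 1) : ℝ) / 4 ^ (2 * s * r)) * (((4 : ℝ) ^ r - 1) / 3) ^ s
    with hD
  have h16 : ((16 : ℝ) ^ r) ^ s = 4 ^ (2 * s * r) := by
    rw [show (16 : ℝ) = 4 ^ 2 by norm_num, ← pow_mul, ← pow_mul]
    congr 1
    ring
  have hlim : (4 : ℝ) ^ (s * p) * ((Nat.doubleFactorial (2 * s - 1) : ℝ) *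
      (((4 : ℝ) ^ r - 1) / (3 * 16 ^ r)) ^ s) = D := by
    rw [hD, Nat.add_sub_cancel, div_pow, mul_pow, h16, div_pow]
    field_simp
  have h4 : 0 < (4 : ℝ) ^ r - 1 := sub_pos.mpr (one_lt_pow₀ (by norm_num) (by omega))
  have hD0 : D ≠ 0 := by
    have : 0 < Nat.doubleFactorial (2 * s - 1) := Nat.doubleFactorial_pos _
    positivity
  rw [hlim] at h
  have h1 := h.div_const D
  rw [div_self hD0] at h1
  refine h1.congr' ?_
  filter_upwards [eventually_ge_atTop 1] with n hn
  have hn0 : (n : ℝ) ≠ 0 := by positivity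
  rw [zpow_neg, zpow_natCast]
  change _ = ratioMoment (p + 1) r s n / _
  field_simp
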